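/- For subadditive valuations with two agents and two goods, the VCG mechanism with h_i equal to the maximum singleton value of the other agent is envy-free and individually rational. Precisely: let v_1, v_2 : (subsets of a two-element set of goods {1, 2}) → ℝ be nonnegative subadditive valuations with v_i(∅) = 0, set h_1 = max(v_2({1}), v_2({2})) and h_2 = max(v_1({1}), v_1({2})). Then for every allocation (a_1, a_2) with a_1 ∪ a_2 = {1, 2}, a_1 ∩ a_2 = ∅, that maximizes v_1(S_1) + v_2(S_2) over all pairs of disjoint bundles, the payments p_1 = h_1 − v_2(a_2) and p_2 = h_2 − v_1(a_1) satisfy envy-freeness (v_1(a_1) − p_1 ≥ v_1(a_2) − p_2 and v_2(a_2) − p_2 ≥ v_2(a_1) − p_1) and individual rationality (v_1(a_1) − p_1 ≥ 0 and v_2(a_2) − p_2 ≥ 0). -/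

import Mathlib

/-- For subadditive valuations with two agents and two goods, the VCG mechanism
with `hᵢ` equal to the maximum singleton value of the other agent is envy-free
and individually rational. -/
theorem subadditive_two_two_EF_IR (v₁ v₂ : Finset (Fin 2) → ℝ)
    (hv₁nonneg : ∀ S, 0 ≤ v₁ S) (hv₂nonneg : ∀ S, 0 ≤ v₂ S)
    (hv₁empty : v₁ ∅ = 0) (hv₂empty : v₂ ∅ = 0)
    (hv₁sub : ∀ S T : Finset (Fin 2), Disjoint S T → v₁ (S ∪ T) ≤ v₁ S + v₁ T)
    (hv₂sub : ∀ S T : Finset (Fin 2), Disjoint S T → v₂ (S ∪ T) ≤ v₂ S + v₂ T)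
    (a₁ a₂ : Finset (Fin 2))
    (hcover : a₁ ∪ a₂ = Finset.univ) (hdisj : Disjoint a₁ a₂)
    (hopt : ∀ S₁ S₂ : Finset (Fin 2), Disjoint S₁ S₂ →
      v₁ S₁ + v₂ S₂ ≤ v₁ a₁ + v₂ a₂)
    (p₁ p₂ : ℝ)
    (hp₁ : p₁ = max (v₂ {0}) (v₂ {1}) - v₂ a₂)
    (hp₂ : p₂ = max (v₁ {0}) (v₁ {1}) - v₁ a₁) :
    (v₁ a₂ - p₂ ≤ v₁ a₁ - p₁) ∧
    (v₂ a₁ - p₁ ≤ v₂ a₂ - p₂) ∧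
    (0 ≤ v₁ a₁ - p₁) ∧
    (0 ≤ v₂ a₂ - p₂) := by
  have hunion : ({0} ∪ {1} : Finset (Fin 2)) = Finset.univ := by decide
  have sub₁ := hv₁sub {0} {1} (by decide)
  have sub₂ := hv₂sub {0} {1} (by decide)
  rw [hunion] at sub₁ sub₂
  have opt₀₁ := hopt {0} {1} (by decide)
  have opt₁₀ := hopt {1} {0} (by decide)
  have opt₀ := hopt {0} ∅ (by decide)
  have opt₁ := hopt {1} ∅ (by decide)
  have opt₀' := hopt ∅ {0} (by decide)
  have opt₁' := hopt ∅ {1} (by decide)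
  have cases_alloc : ∀ S T : Finset (Fin 2), S ∪ T = Finset.univ → Disjoint S T →
      (S = ∅ ∧ T = Finset.univ) ∨ (S = {0} ∧ T = {1}) ∨
      (S = {1} ∧ T = {0}) ∨ (S = Finset.univ ∧ T = ∅) := by decide
  subst hp₁ hp₂
  rcases cases_alloc a₁ a₂ hcover hdisj with ⟨rfl, rfl⟩ | ⟨rfl, rfl⟩ | ⟨rfl, rfl⟩ | ⟨rfl, rfl⟩ <;>
  rcases max_cases (v₁ {0}) (v₁ {1}) with ⟨h₁, _⟩ | ⟨h₁, _⟩ <;>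
  rcases max_cases (v₂ {0}) (v₂ {1}) with ⟨h₂, _⟩ | ⟨h₂, _⟩ <;>
  rw [h₁, h₂] <;>
  refine ⟨?_, ?_, ?_, ?_⟩ <;>
  linarith
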